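/- Let D be a dataset over ι, and for k = 1, …, hw fix j_k ∈ ι and P_k ⊆ ι \ {j_k}; let f_k : (∀ i, α i) → ℝ≥0 be the empirical conditional probability table f_k(v) = P_D( v(j_k) | v restricted to P_k ), which has scope {j_k} ∪ P_k. Then for any Z ⊆ ⋃_k ({j_k} ∪ P_k), the marginalized cluster product v ↦ ∑ over assignments z to Z of ∏_{k=1}^{hw} f_k(v updated on Z by z) has tightness at most |D|^{hw} relative to its scope (⋃_k ({j_k} ∪ P_k)) \ Z. (This is the space bound O(t^{hw}) for processing an empirical Bayesian network by cluster-tree elimination over a hypertree decomposition of hypertree width hw, with t the data size.) -/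

import Mathlib

/-! STATEMENT 10: for empirical conditional probability tables f_k built from a
dataset D (scope {j_k} ∪ P_k each), the marginalized cluster product over any
Z ⊆ ⋃_k ({j_k} ∪ P_k) has tightness at most |D|^hw relative to its scope
(⋃_k ({j_k} ∪ P_k)) \ Z. -/

open Finset
open scoped NNReal

variable {ι : Type*} [Fintype ι] [DecidableEq ι]
variable {α : ι → Type*} [∀ i, Fintype (α i)] [∀ i, DecidableEq (α i)]
  [∀ i, Nonempty (α i)]

/-- Restriction of a full assignment to the variables in `S`. -/
def restrictTo (S : Finset ι) (v : ∀ i, α i) : ∀ i : S, α i := fun i => v i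

/-- The count `#D(s)`: number of records of `D` whose restriction to `S` is `s`. -/
def count (D : List (∀ i, α i)) (S : Finset ι) (s : ∀ i : S, α i) : ℕ :=
  D.countP (fun v => decide (restrictTo S v = s))

/-- The partial assignment on `{j} ∪ P` determined by `x : α j` and `pa` on `P`. -/
def pairAssign (j : ι) (P : Finset ι) (x : α j) (pa : ∀ i : P, α i) :
    ∀ i : (insert j P : Finset ι), α i := fun i =>
  if h : (i : ι) ∈ P then pa ⟨i, h⟩
  else cast (congrArg α ((Finset.mem_insert.mp i.2).resolve_right h).symm) x

/-- Empirical conditional probability `P_D(x | pa)`, as a nonnegative real. -/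
noncomputable def condP (D : List (∀ i, α i)) (j : ι) (P : Finset ι)
    (x : α j) (pa : ∀ i : P, α i) : ℝ≥0 :=
  if 0 < count D P pa then
    (count D (insert j P) (pairAssign j P x pa) : ℝ≥0) / (count D P pa : ℝ≥0)
  else 0

/-- The support of `f` relative to a scope `S`. -/
def supportOn (f : (∀ i, α i) → ℝ≥0) (S : Finset ι) : Set (∀ i : S, α i) :=
  {s | ∃ v : ∀ i, α i, restrictTo S v = s ∧ f v ≠ 0}

/-- The tightness of `f` relative to `S`: the number of nonzero configurations. -/
noncomputable def tightness (f : (∀ i, α i) → ℝ≥0) (S : Finset ι) : ℕ :=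
  (supportOn f S).ncard

/-- `v` updated on the variables of `Z` by the partial assignment `z`. -/
def updateOn (v : ∀ i, α i) (Z : Finset ι) (z : ∀ i : Z, α i) : ∀ i, α i :=
  fun i => if h : i ∈ Z then z ⟨i, h⟩ else v i

theorem pairAssign_restrictTo (j : ι) (P : Finset ι) (w : ∀ i, α i) :
    pairAssign j P (w j) (restrictTo P w) = restrictTo (insert j P) w := by
  funext ⟨i, hi⟩
  by_cases h : i ∈ P
  · simp [pairAssign, restrictTo, h]
  · obtain rfl : i = j := (Finset.mem_insert.mp hi).resolve_right h
    simp [pairAssign, restrictTo, h]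

/-- A nonzero empirical conditional probability is witnessed by a record of the dataset. -/
theorem exists_record_of_condP_ne_zero (D : List (∀ i, α i)) (j : ι) (P : Finset ι)
    (w : ∀ i, α i) (h : condP D j P (w j) (restrictTo P w) ≠ 0) :
    ∃ n : Fin D.length, ∀ i ∈ insert j P, D.get n i = w i := by
  have hcount : 0 < count D (insert j P) (restrictTo (insert j P) w) := by
    rw [Nat.pos_iff_ne_zero]
    intro h0
    simp [condP, pairAssign_restrictTo, h0] at h
  obtain ⟨u, hu, huw⟩ := List.countP_pos_iff.mp hcount
  obtain ⟨n, rfl⟩ := List.get_of_mem hu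
  exact ⟨n, fun i hi => congrFun (of_decide_eq_true huw) ⟨i, hi⟩⟩

theorem tightness_empirical_cluster (D : List (∀ i, α i)) (hD : D ≠ [])
    (hw : ℕ) (j : Fin hw → ι) (P : Fin hw → Finset ι) (hjP : ∀ k, j k ∉ P k)
    (Z : Finset ι) (hZ : Z ⊆ Finset.univ.biUnion fun k => insert (j k) (P k)) :
    tightness
        (fun v => ∑ z : ∀ i : Z, α i, ∏ k,
          condP D (j k) (P k) (updateOn v Z z (j k)) (restrictTo (P k) (updateOn v Z z)))
        ((Finset.univ.biUnion fun k => insert (j k) (P k)) \ Z)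
      ≤ D.length ^ hw := by
  have witness : ∀ s : supportOn (fun v => ∑ z : ∀ i : Z, α i, ∏ k,
      condP D (j k) (P k) (updateOn v Z z (j k)) (restrictTo (P k) (updateOn v Z z)))
      ((Finset.univ.biUnion fun k => insert (j k) (P k)) \ Z),
      ∃ r : Fin hw → Fin D.length,
        ∀ (i : ((Finset.univ.biUnion fun k => insert (j k) (P k)) \ Z : Finset ι)) (k),
          i.1 ∈ insert (j k) (P k) → D.get (r k) i = s.1 i := by
    rintro ⟨_, v, rfl, hv⟩
    obtain ⟨z, -, hz⟩ := Finset.exists_ne_zero_of_sum_ne_zero hv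
    choose r hr using fun k => exists_record_of_condP_ne_zero D (j k) (P k) (updateOn v Z z)
      (Finset.prod_ne_zero_iff.mp hz k (Finset.mem_univ k))
    refine ⟨r, fun i k hik => (hr k i hik).trans ?_⟩
    simp [updateOn, restrictTo, (Finset.mem_sdiff.mp i.2).2]
  choose r hr using witness
  have r_injective : Function.Injective r := by
    intro s t hst
    ext i
    obtain ⟨k, -, hik⟩ := Finset.mem_biUnion.mp (Finset.mem_sdiff.mp i.2).1
    rw [← hr s i k hik, ← hr t i k hik, hst]
  simpa [tightness] using Nat.card_le_card_of_injective r r_injective
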